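/- arXiv:1401.4138 — 8 statements merged into one kernel-verified Lean document; each statement's English description precedes it below -/
import Mathlib

section
/- For all integers N ≥ 2 and m with 0 ≤ m ≤ N, the sum ∑_{k=1}^{N-1} exp(i·m·2πk/N)/sin²(πk/N) equals the real number 2(m − N/2)² − N²/6 − 1/3. -/
/-- A sequence with constant second difference `4` on `[0, N]`, equal values at `0` and `N`, and
zero sum over `[0, N)` is an explicit quadratic polynomial. -/
lemma eq_quadratic_of_second_difference {N : ℕ} (hN : N ≠ 0) {f : ℕ → ℂ}
    (hdiff : ∀ m, m + 2 ≤ N → f (m + 2) - 2 * f (m + 1) + f m = 4)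
    (hper : f N = f 0) (hsum : ∑ m ∈ Finset.range N, f m = 0) {m : ℕ} (hm : m ≤ N) :
    f m = 2 * ((m : ℂ) - N / 2) ^ 2 - (N : ℂ) ^ 2 / 6 - 1 / 3 := by
  have hN' : (N : ℂ) ≠ 0 := Nat.cast_ne_zero.mpr hN
  have hquad : ∀ m, m ≤ N → f m = f 0 + (f 1 - f 0 - 2) * m + 2 * (m : ℂ) ^ 2 := by
    intro m
    induction m using Nat.twoStepInduction with
    | zero => intro _; simp
    | one => intro _; push_cast; ring
    | more n ih₀ ih₁ =>
      intro hn
      have h₀ := ih₀ (by omega)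
      have h₁ := ih₁ (by omega)
      have h₂ := hdiff n hn
      push_cast at h₁ ⊢
      linear_combination h₂ + 2 * h₁ - h₀
  have hslope : f 1 - f 0 - 2 = -2 * N := by
    have h := hquad N le_rfl
    rw [hper] at h
    apply mul_right_cancel₀ hN'
    linear_combination -h
  have hpartial : ∀ n, n ≤ N → ∑ j ∈ Finset.range n, f j =
      n * f 0 - N * (n * (n - 1)) + n * (n - 1) * (2 * n - 1) / 3 := by
    intro n
    induction n with
    | zero => intro _; simp
    | succ n ih =>
      intro hn
      rw [Finset.sum_range_succ, ih (by omega), hquad n (by omega), hslope]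
      push_cast
      ring
  have hzero : f 0 = ((N : ℂ) ^ 2 - 1) / 3 := by
    have h := hpartial N le_rfl
    rw [hsum] at h
    apply mul_left_cancel₀ hN'
    linear_combination -h
  rw [hquad m hm, hslope, hzero]
  ring

lemma geom_sum_eq_zero_of_pow_eq_one {w : ℂ} {N : ℕ} (hw : w ≠ 1) (hwN : w ^ N = 1) :
    ∑ j ∈ Finset.range N, w ^ j = 0 := by
  rw [geom_sum_eq hw, hwN, sub_self, zero_div]

lemma exp_two_mul_I_sub_one_sq (x : ℂ) :
    (Complex.exp (2 * x * Complex.I) - 1) ^ 2 =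
      -4 * Complex.exp (2 * x * Complex.I) * Complex.sin x ^ 2 := by
  have h : Complex.exp (2 * x * Complex.I) = (Complex.cos x + Complex.sin x * Complex.I) ^ 2 := by
    rw [← Complex.exp_mul_I, ← Complex.exp_nat_mul]
    push_cast
    ring_nf
  rw [h]
  have hI := Complex.I_sq
  have hc : Complex.cos x ^ 2 = 1 - Complex.sin x ^ 2 := Complex.cos_sq' x
  have h1 : (Complex.cos x + Complex.sin x * Complex.I) ^ 2 - 1 =
      2 * Complex.I * Complex.sin x * (Complex.cos x + Complex.sin x * Complex.I) := by
    linear_combination hc - Complex.sin x ^ 2 * hI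
  rw [h1]
  linear_combination 4 * Complex.sin x ^ 2 *
    (Complex.cos x + Complex.sin x * Complex.I) ^ 2 * hI

theorem sum_exp_div_sin_sq (N m : ℕ) (hN : 2 ≤ N) (hm : m ≤ N) :
    ∑ k ∈ Finset.Icc 1 (N - 1),
        Complex.exp (Complex.I * m * (2 * Real.pi * k) / N)
          / ((Real.sin (Real.pi * k / N) : ℂ)) ^ 2
      = ((2 * ((m : ℝ) - N / 2) ^ 2 - (N : ℝ) ^ 2 / 6 - 1 / 3 : ℝ) : ℂ) := by
  have hN₀ : N ≠ 0 := by omega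
  set ζ : ℂ := Complex.exp (2 * Real.pi * Complex.I / N) with hζ_def
  have hζ : IsPrimitiveRoot ζ N := Complex.isPrimitiveRoot_exp N hN₀
  have hroot : ∀ k, (ζ ^ k) ^ N = 1 := fun k => by
    rw [← pow_mul, mul_comm, pow_mul, hζ.pow_eq_one, one_pow]
  have hne : ∀ k, 1 ≤ k → k < N → ζ ^ k ≠ 1 := fun k h₁ h₂ =>
    hζ.pow_ne_one_of_pos_of_lt (by omega) h₂
  have hsq : ∀ k : ℕ, (ζ ^ k - 1) ^ 2 =
      -4 * ζ ^ k * (Real.sin (Real.pi * k / N) : ℂ) ^ 2 := fun k => by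
    have h : ζ ^ k = Complex.exp (2 * (Real.pi * k / N) * Complex.I) := by
      rw [hζ_def, ← Complex.exp_nat_mul]
      ring_nf
    rw [h, exp_two_mul_I_sub_one_sq]
    push_cast
    rfl
  have hsin : ∀ k : ℕ, 1 ≤ k → k < N → (Real.sin (Real.pi * k / N) : ℂ) ≠ 0 := by
    intro k h₁ h₂ h
    have := hsq k
    rw [h] at this
    exact hne k h₁ h₂ (sub_eq_zero.mp (by simpa using this))
  set f : ℕ → ℂ := fun m => ∑ k ∈ Finset.Icc 1 (N - 1),
    (ζ ^ k) ^ m / (Real.sin (Real.pi * k / N) : ℂ) ^ 2 with hf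
  have hlhs : ∑ k ∈ Finset.Icc 1 (N - 1),
        Complex.exp (Complex.I * m * (2 * Real.pi * k) / N)
          / ((Real.sin (Real.pi * k / N) : ℂ)) ^ 2 = f m := by
    refine Finset.sum_congr rfl fun k _ => ?_
    rw [← pow_mul, hζ_def, ← Complex.exp_nat_mul]
    congr 2
    push_cast
    ring
  rw [hlhs, eq_quadratic_of_second_difference hN₀ (f := f) ?_ ?_ ?_ hm]
  · push_cast
    ring
  · intro n hn
    have hgeom : ∑ k ∈ Finset.Icc 1 (N - 1), (ζ ^ k) ^ (n + 1) = -1 := by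
      have h := geom_sum_eq_zero_of_pow_eq_one (hne (n + 1) (by omega) (by omega)) (hroot (n + 1))
      have hIcc : Finset.Icc 1 (N - 1) = Finset.Ico 1 N := by
        ext k
        simp only [Finset.mem_Icc, Finset.mem_Ico]
        omega
      rw [Finset.range_eq_Ico, Finset.sum_eq_sum_Ico_succ_bot (by omega), pow_zero] at h
      rw [hIcc, Finset.sum_congr rfl fun k _ => pow_right_comm ζ k (n + 1)]
      linear_combination h
    have hterm : f (n + 2) - 2 * f (n + 1) + f n =
        ∑ k ∈ Finset.Icc 1 (N - 1), -4 * (ζ ^ k) ^ (n + 1) := by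
      simp only [hf]
      rw [Finset.mul_sum, ← Finset.sum_sub_distrib, ← Finset.sum_add_distrib]
      refine Finset.sum_congr rfl fun k hk => ?_
      rw [Finset.mem_Icc] at hk
      have hs := hsin k hk.1 (by omega)
      have hk₂ := hsq k
      generalize ζ ^ k = z at *
      field_simp
      linear_combination z ^ n * hk₂
    rw [hterm, ← Finset.mul_sum, hgeom]
    norm_num
  · simp only [hf, hroot, pow_zero]
  · simp only [hf]
    rw [Finset.sum_comm]
    refine Finset.sum_eq_zero fun k hk => ?_
    rw [Finset.mem_Icc] at hk
    rw [← Finset.sum_div, geom_sum_eq_zero_of_pow_eq_one (hne k hk.1 (by omega)) (hroot k),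
      zero_div]
end

section
/- For all integers N ≥ 2 and m with 0 ≤ m ≤ N, the sum ∑_{k=1}^{N-1} (exp(i·2πk/N) − exp(i·m·2πk/N))/sin²(πk/N) equals the real number 2(m−1)(N−m−1). -/
namespace IsPrimitiveRoot

variable {K : Type*} [Field K] {ζ : K} {N : ℕ}

theorem pow_sub_one_ne_zero_of_mem_Icc (hζ : IsPrimitiveRoot ζ N) {k : ℕ}
    (hk : k ∈ Finset.Icc 1 (N - 1)) : ζ ^ k - 1 ≠ 0 := by
  rw [Finset.mem_Icc] at hk
  exact sub_ne_zero.mpr (hζ.pow_ne_one_of_pos_of_lt (by omega) (by omega))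

theorem sum_Icc_pow_pow (hζ : IsPrimitiveRoot ζ N) {j : ℕ} (hj : j ≠ 0) (hjN : j < N) :
    ∑ k ∈ Finset.Icc 1 (N - 1), (ζ ^ k) ^ j = -1 := by
  have hne : ζ ^ j ≠ 1 := hζ.pow_ne_one_of_pos_of_lt hj hjN
  have hgeom : ∑ k ∈ Finset.range N, (ζ ^ j) ^ k = 0 := by
    rw [geom_sum_eq hne, ← pow_mul, mul_comm, pow_mul, hζ.pow_eq_one]
    simp
  have hrange : Finset.range N = insert 0 (Finset.Icc 1 (N - 1)) := by
    ext k
    simp only [Finset.mem_range, Finset.mem_insert, Finset.mem_Icc]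
    omega
  rw [hrange, Finset.sum_insert (by simp), pow_zero] at hgeom
  rw [← add_eq_zero_iff_eq_neg', ← hgeom]
  simp only [← pow_mul, mul_comm]

theorem two_mul_sum_Icc_div_sub_one (hζ : IsPrimitiveRoot ζ N) (hN : 1 ≤ N) :
    2 * ∑ k ∈ Finset.Icc 1 (N - 1), ζ ^ k / (ζ ^ k - 1) = (N : K) - 1 := by
  have hreflect : ∑ k ∈ Finset.Icc 1 (N - 1), ζ ^ k / (ζ ^ k - 1)
      = ∑ k ∈ Finset.Icc 1 (N - 1), ζ ^ (N - k) / (ζ ^ (N - k) - 1) := by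
    refine Finset.sum_nbij' (fun k => N - k) (fun k => N - k) ?_ ?_ ?_ ?_ ?_ <;>
      intro k hk <;> rw [Finset.mem_Icc] at hk
    · rw [Finset.mem_Icc]; omega
    · rw [Finset.mem_Icc]; omega
    · omega
    · omega
    · rw [show N - (N - k) = k by omega]
  rw [two_mul]
  nth_rewrite 2 [hreflect]
  rw [← Finset.sum_add_distrib, Finset.sum_congr rfl (g := fun _ => (1 : K))]
  · simp [Nat.cast_sub hN]
  · intro k hk
    have hk1 := hζ.pow_sub_one_ne_zero_of_mem_Icc hk
    have hk2 : ζ ^ (N - k) - 1 ≠ 0 := by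
      apply hζ.pow_sub_one_ne_zero_of_mem_Icc
      rw [Finset.mem_Icc] at hk ⊢
      omega
    have hmul : ζ ^ k * ζ ^ (N - k) = 1 := by
      rw [Finset.mem_Icc] at hk
      rw [← pow_add, Nat.add_sub_cancel' (by omega), hζ.pow_eq_one]
    rw [div_add_div _ _ hk1 hk2, div_eq_one_iff_eq (mul_ne_zero hk1 hk2)]
    linear_combination hmul

theorem two_mul_sum_Icc_pow_div_sub_one (hζ : IsPrimitiveRoot ζ N) {m : ℕ} (hm : m < N) :
    2 * ∑ k ∈ Finset.Icc 1 (N - 1), (ζ ^ k) ^ (m + 1) / (ζ ^ k - 1) = (N : K) - 1 - 2 * m := by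
  induction m with
  | zero => simpa using hζ.two_mul_sum_Icc_div_sub_one (by omega)
  | succ m ih =>
    have hstep : ∑ k ∈ Finset.Icc 1 (N - 1), (ζ ^ k) ^ (m + 1 + 1) / (ζ ^ k - 1)
        = ∑ k ∈ Finset.Icc 1 (N - 1), (ζ ^ k) ^ (m + 1) / (ζ ^ k - 1)
          + ∑ k ∈ Finset.Icc 1 (N - 1), (ζ ^ k) ^ (m + 1) := by
      rw [← Finset.sum_add_distrib]
      refine Finset.sum_congr rfl fun k hk => ?_
      have hk1 := hζ.pow_sub_one_ne_zero_of_mem_Icc hk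
      field_simp
      ring
    rw [hstep, mul_add, ih (by omega), hζ.sum_Icc_pow_pow (by omega) hm]
    push_cast
    ring

theorem sum_Icc_sub_pow_mul_div_sub_one_sq (hζ : IsPrimitiveRoot ζ N) (hN : 1 ≤ N) {m : ℕ}
    (hm : m ≤ N) :
    ∑ k ∈ Finset.Icc 1 (N - 1), (ζ ^ k - (ζ ^ k) ^ m) * (-4 * ζ ^ k / (ζ ^ k - 1) ^ 2)
      = 2 * ((m : K) - 1) * ((N : K) - m - 1) := by
  induction m with
  | zero =>
    have hterm : ∑ k ∈ Finset.Icc 1 (N - 1),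
        (ζ ^ k - (ζ ^ k) ^ 0) * (-4 * ζ ^ k / (ζ ^ k - 1) ^ 2)
        = -2 * (2 * ∑ k ∈ Finset.Icc 1 (N - 1), ζ ^ k / (ζ ^ k - 1)) := by
      rw [← mul_assoc, Finset.mul_sum]
      refine Finset.sum_congr rfl fun k hk => ?_
      have hk1 := hζ.pow_sub_one_ne_zero_of_mem_Icc hk
      field_simp
      ring
    rw [hterm, hζ.two_mul_sum_Icc_div_sub_one hN]
    push_cast
    ring
  | succ m ih =>
    have hstep : ∑ k ∈ Finset.Icc 1 (N - 1),
        (ζ ^ k - (ζ ^ k) ^ (m + 1)) * (-4 * ζ ^ k / (ζ ^ k - 1) ^ 2)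
        = ∑ k ∈ Finset.Icc 1 (N - 1), (ζ ^ k - (ζ ^ k) ^ m) * (-4 * ζ ^ k / (ζ ^ k - 1) ^ 2)
          + 2 * (2 * ∑ k ∈ Finset.Icc 1 (N - 1), (ζ ^ k) ^ (m + 1) / (ζ ^ k - 1)) := by
      rw [← mul_assoc, Finset.mul_sum, ← Finset.sum_add_distrib]
      refine Finset.sum_congr rfl fun k hk => ?_
      have hk1 := hζ.pow_sub_one_ne_zero_of_mem_Icc hk
      field_simp
      ring
    rw [hstep, ih (by omega), hζ.two_mul_sum_Icc_pow_div_sub_one (by omega)]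
    push_cast
    ring

end IsPrimitiveRoot

theorem Complex.neg_four_mul_exp_mul_sin_sq (x : ℂ) :
    -4 * Complex.exp (2 * x * Complex.I) * Complex.sin x ^ 2
      = (Complex.exp (2 * x * Complex.I) - 1) ^ 2 := by
  have hsq : Complex.exp (2 * x * Complex.I) = Complex.exp (x * Complex.I) ^ 2 := by
    rw [← Complex.exp_nat_mul]
    push_cast
    ring_nf
  have hinv : Complex.exp (-x * Complex.I) = (Complex.exp (x * Complex.I))⁻¹ := by
    rw [neg_mul, Complex.exp_neg]
  have hne := Complex.exp_ne_zero (x * Complex.I)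
  rw [Complex.sin, hsq, hinv]
  field_simp
  rw [Complex.I_sq]
  ring

theorem sum_exp_diff_div_sin_sq (N m : ℕ) (hN : 2 ≤ N) (hm : m ≤ N) :
    ∑ k ∈ Finset.Icc 1 (N - 1),
        (Complex.exp (Complex.I * (2 * Real.pi * k) / N)
            - Complex.exp (Complex.I * m * (2 * Real.pi * k) / N))
          / ((Real.sin (Real.pi * k / N) : ℂ)) ^ 2
      = ((2 * ((m : ℝ) - 1) * ((N : ℝ) - m - 1) : ℝ) : ℂ) := by
  have hζ := Complex.isPrimitiveRoot_exp N (by omega)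
  push_cast
  rw [← hζ.sum_Icc_sub_pow_mul_div_sub_one_sq (by omega) hm]
  refine Finset.sum_congr rfl fun k hk => ?_
  have hk1 := hζ.pow_sub_one_ne_zero_of_mem_Icc hk
  have hz : Complex.exp (2 * Real.pi * Complex.I / N) ^ k
      = Complex.exp (2 * (Real.pi * k / N) * Complex.I) := by
    rw [← Complex.exp_nat_mul]
    ring_nf
  have hz1 : Complex.exp (Complex.I * (2 * Real.pi * k) / N)
      = Complex.exp (2 * (Real.pi * k / N) * Complex.I) := by
    ring_nf
  have hzm : Complex.exp (Complex.I * m * (2 * Real.pi * k) / N)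
      = Complex.exp (2 * (Real.pi * k / N) * Complex.I) ^ m := by
    rw [← Complex.exp_nat_mul]
    ring_nf
  rw [hz] at hk1 ⊢
  have hsin := Complex.neg_four_mul_exp_mul_sin_sq (Real.pi * k / N)
  have hsin_ne : Complex.sin (Real.pi * k / N) ^ 2 ≠ 0 := by
    intro h
    rw [h, mul_zero] at hsin
    exact pow_ne_zero 2 hk1 hsin.symm
  rw [hz1, hzm, div_eq_mul_inv, ← hsin]
  congr 1
  have hexp := Complex.exp_ne_zero (2 * (Real.pi * k / N) * Complex.I)
  rw [← div_div, div_self (mul_ne_zero (by norm_num) hexp), one_div]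
end

section
/- Let L be an n×n complex matrix with Lᵀ = L (complex symmetric), let d be a real number, and let A be the 2n×2n block matrix A = [[d·I, L],[conj(L), d·I]], where conj(L) is the entrywise complex conjugate of L. Then a complex number μ lies in the spectrum of A if and only if (μ − d)² lies in the spectrum of L·conj(L). -/
namespace Matrix

variable {m R : Type*} [Fintype m] [DecidableEq m] [CommRing R]

theorem det_smul_one_sub_mul_comm (B C : Matrix m m R) (c : R) :
    (c • (1 : Matrix m m R) - B * C).det = (c • (1 : Matrix m m R) - C * B).det := by
  simpa only [eval_charpoly, scalar_apply, ← smul_one_eq_diagonal] using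
    congrArg (Polynomial.eval c) (charpoly_mul_comm B C)

theorem det_fromBlocks_smul_one_neg (B C : Matrix m m R) (c : R) :
    (fromBlocks (c • 1) (-B) (-C) (c • 1)).det = (fromBlocks (c • 1) B C (c • 1)).det := by
  have h : fromBlocks (c • 1) (-B) (-C) (c • 1) =
      fromBlocks 1 0 0 (-1) * fromBlocks (c • 1) B C (c • 1) *
        (fromBlocks 1 0 0 (-1) : Matrix (m ⊕ m) (m ⊕ m) R) := by
    simp [fromBlocks_multiply]
  have hs : (fromBlocks 1 0 0 (-1) : Matrix (m ⊕ m) (m ⊕ m) R) * fromBlocks 1 0 0 (-1) = 1 := by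
    simp [fromBlocks_multiply]
  rw [h, det_mul_comm, ← mul_assoc, hs, one_mul]

theorem det_fromBlocks_smul_one_sq (B C : Matrix m m R) (c : R) :
    (fromBlocks (c • 1) (-B) (-C) (c • 1)).det ^ 2 =
      (c ^ 2 • (1 : Matrix m m R) - B * C).det ^ 2 := by
  have h : fromBlocks (c • 1) (-B) (-C) (c • 1) * fromBlocks (c • 1) B C (c • 1) =
      fromBlocks (c ^ 2 • (1 : Matrix m m R) - B * C) 0 0 (c ^ 2 • 1 - C * B) := by
    simp [fromBlocks_multiply, smul_smul, sq, sub_eq_add_neg, add_comm]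
  rw [sq, sq]
  nth_rewrite 2 [det_fromBlocks_smul_one_neg]
  rw [← det_mul, h, det_fromBlocks_zero₂₁, det_smul_one_sub_mul_comm C B]

theorem mem_spectrum_fromBlocks_smul_one_iff (B C : Matrix m m R) (d μ : R) :
    μ ∈ spectrum R (fromBlocks (d • 1) B C (d • 1)) ↔ (μ - d) ^ 2 ∈ spectrum R (B * C) := by
  have h : algebraMap R (Matrix (m ⊕ m) (m ⊕ m) R) μ - fromBlocks (d • 1) B C (d • 1) =
      fromBlocks ((μ - d) • 1) (-B) (-C) ((μ - d) • 1) := by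
    rw [Algebra.algebraMap_eq_smul_one, ← fromBlocks_one, fromBlocks_smul, sub_eq_add_neg,
      fromBlocks_neg, fromBlocks_add]
    simp [sub_smul, ← sub_eq_add_neg]
  rw [spectrum.mem_iff, spectrum.mem_iff, h, isUnit_iff_isUnit_det, isUnit_iff_isUnit_det,
    Algebra.algebraMap_eq_smul_one, ← isUnit_pow_iff two_ne_zero, det_fromBlocks_smul_one_sq,
    isUnit_pow_iff two_ne_zero]

end Matrix

theorem blockA_spectrum_iff {n : ℕ} (L : Matrix (Fin n) (Fin n) ℂ)
    (hL : L.transpose = L) (d : ℝ)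
    (A : Matrix (Fin n ⊕ Fin n) (Fin n ⊕ Fin n) ℂ)
    (hA : A = Matrix.fromBlocks ((d : ℂ) • (1 : Matrix (Fin n) (Fin n) ℂ)) L
        (L.map (starRingEnd ℂ)) ((d : ℂ) • (1 : Matrix (Fin n) (Fin n) ℂ))) :
    ∀ μ : ℂ, μ ∈ spectrum ℂ A ↔ (μ - d) ^ 2 ∈ spectrum ℂ (L * L.map (starRingEnd ℂ)) := by
  intro μ
  rw [hA, Matrix.mem_spectrum_fromBlocks_smul_one_iff]
end

section
/- Let L be an n×n complex matrix with Lᵀ = L (complex symmetric), let d be a real number, and let B be the 2n×2n block matrix B = [[i·d·I, i·L],[−i·conj(L), −i·d·I]]. Then a complex number μ lies in the spectrum of B if and only if μ² + d² lies in the spectrum of L·conj(L). Consequently, every eigenvalue of B is purely imaginary if and only if every eigenvalue ε of L·conj(L) satisfies ε ≤ d². -/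
namespace Matrix

variable {n R : Type*} [Fintype n] [DecidableEq n] [CommRing R]

theorem det_fromBlocks_smul_one_mul_pow (x y : R) (A C : Matrix n n R) :
    (fromBlocks (x • 1) A C (y • 1)).det * y ^ Fintype.card n =
      ((x * y) • 1 - A * C).det * y ^ Fintype.card n := by
  have h : fromBlocks (x • 1) A C (y • 1) * fromBlocks (y • 1) 0 (-C) 1 =
      fromBlocks ((x * y) • 1 - A * C) A 0 (y • 1) := by
    simp [fromBlocks_multiply, smul_smul, sub_eq_add_neg, mul_comm y x]
  have h' := congrArg det h
  simpa [det_mul, det_fromBlocks_zero₁₂, det_fromBlocks_zero₂₁] using h'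

open Polynomial in
theorem det_fromBlocks_smul_one (x y : R) (A C : Matrix n n R) :
    (fromBlocks (x • 1) A C (y • 1)).det = ((x * y) • 1 - A * C).det := by
  have h := det_fromBlocks_smul_one_mul_pow (Polynomial.C x) (X + Polynomial.C y)
    (A.map Polynomial.C) (C.map Polynomial.C)
  have h' := congrArg (eval 0) (((monic_X_add_C y).pow (Fintype.card n)).isRegular.right h)
  rw [← coe_evalRingHom, RingHom.map_det, RingHom.map_det] at h'
  convert! h' using 2
  · ext (i | i) (j | j) <;> simp [one_apply, apply_ite (eval (0 : R))]
  · ext i j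
    simp [one_apply, mul_apply, eval_finsetSum, apply_ite (eval (0 : R))]

end Matrix

theorem Complex.sq_nonpos_iff_re_eq_zero (μ : ℂ) :
    ((μ ^ 2).re ≤ 0 ∧ (μ ^ 2).im = 0) ↔ μ.re = 0 := by
  simp only [pow_two, Complex.mul_re, Complex.mul_im]
  constructor
  · rintro ⟨h₁, h₂⟩
    have h : μ.re * μ.im = 0 := by linarith
    rcases mul_eq_zero.mp h with h | h
    · exact h
    · rw [h] at h₁
      nlinarith
  · intro h
    simp only [h]
    constructor <;> nlinarith [sq_nonneg μ.im]

open scoped ComplexOrder in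
theorem Complex.sq_add_le_iff_re_eq_zero (μ : ℂ) (d : ℝ) :
    μ ^ 2 + (d : ℂ) ^ 2 ≤ (d : ℂ) ^ 2 ↔ μ.re = 0 := by
  rw [add_le_iff_nonpos_left, Complex.le_def]
  exact Complex.sq_nonpos_iff_re_eq_zero μ


open scoped ComplexOrder in
theorem blockB_spectrum_iff {n : ℕ} (L : Matrix (Fin n) (Fin n) ℂ)
    (hL : L.transpose = L) (d : ℝ)
    (B : Matrix (Fin n ⊕ Fin n) (Fin n ⊕ Fin n) ℂ)
    (hB : B = Matrix.fromBlocks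
        ((Complex.I * d) • (1 : Matrix (Fin n) (Fin n) ℂ))
        (Complex.I • L)
        ((-Complex.I) • L.map (starRingEnd ℂ))
        ((-(Complex.I * d)) • (1 : Matrix (Fin n) (Fin n) ℂ))) :
    (∀ μ : ℂ, μ ∈ spectrum ℂ B
        ↔ μ ^ 2 + (d : ℂ) ^ 2 ∈ spectrum ℂ (L * L.map (starRingEnd ℂ)))
    ∧ ((∀ μ ∈ spectrum ℂ B, μ.re = 0)
        ↔ (∀ ε ∈ spectrum ℂ (L * L.map (starRingEnd ℂ)), ε ≤ ((d : ℝ) ^ 2 : ℂ))) := by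
  have h : ∀ μ : ℂ, μ ∈ spectrum ℂ B
      ↔ μ ^ 2 + (d : ℂ) ^ 2 ∈ spectrum ℂ (L * L.map (starRingEnd ℂ)) := by
    intro μ
    have hμ : algebraMap ℂ _ μ - B = Matrix.fromBlocks ((μ - Complex.I * d) • 1)
        (-(Complex.I • L)) (Complex.I • L.map (starRingEnd ℂ)) ((μ + Complex.I * d) • 1) := by
      rw [hB, Algebra.algebraMap_eq_smul_one, ← Matrix.fromBlocks_one, Matrix.fromBlocks_smul,
        sub_eq_add_neg, Matrix.fromBlocks_neg, Matrix.fromBlocks_add]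
      simp [add_smul, sub_eq_add_neg]
    have hd : (μ - Complex.I * d) * (μ + Complex.I * d) = μ ^ 2 + (d : ℂ) ^ 2 := by
      linear_combination (-(d : ℂ) ^ 2) * Complex.I_sq
    rw [spectrum.mem_iff, spectrum.mem_iff, Matrix.isUnit_iff_isUnit_det,
      Matrix.isUnit_iff_isUnit_det, hμ, Matrix.det_fromBlocks_smul_one, hd,
      Algebra.algebraMap_eq_smul_one]
    simp [smul_smul]
  refine ⟨h, fun hre ε hε => ?_, fun hε μ hμ => ?_⟩
  · obtain ⟨μ, hμ⟩ := IsAlgClosed.exists_pow_nat_eq (ε - (d : ℂ) ^ 2) two_pos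
    obtain rfl : ε = μ ^ 2 + (d : ℂ) ^ 2 := by rw [hμ, sub_add_cancel]
    exact (Complex.sq_add_le_iff_re_eq_zero μ d).mpr (hre μ ((h μ).mpr hε))
  · exact (Complex.sq_add_le_iff_re_eq_zero μ d).mp (hε _ ((h μ).mp hμ))
end

section
/- Let g : [0,∞) → ℝ be continuous with compact support, and let x ∈ ℝ² with r := |x| > 0. Then the integral ∫_{ℝ²} ((x − y)/|x − y|²)·g(|y|) dy exists and equals (2π/r²)·(∫₀^r g(s)·s ds)·x. -/
open MeasureTheory

open Complex in
/-- The circle average of the Cauchy kernel `w ↦ (z - w)⁻¹` over a circle centred at the origin. -/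
theorem circleAverage_sub_inv_eq_ite {z : ℂ} (hz : z ≠ 0) {ρ : ℝ} (hρ : 0 < ρ) (hne : ρ ≠ ‖z‖) :
    Real.circleAverage (fun w ↦ (z - w)⁻¹) 0 ρ = if ρ < ‖z‖ then z⁻¹ else 0 := by
  have hw0 : ∀ w ∈ Metric.sphere (0 : ℂ) ρ, w ≠ 0 := by
    rintro w hw rfl
    simp at hw
    exact hρ.ne hw
  have hwz : ∀ w ∈ Metric.sphere (0 : ℂ) ρ, w - z ≠ 0 := by
    intro w hw h
    rw [sub_eq_zero] at h
    subst h
    exact hne (by simpa using hw.symm)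
  have h1 : CircleIntegrable (fun w : ℂ ↦ w⁻¹) 0 ρ :=
    (continuousOn_id.inv₀ hw0).circleIntegrable hρ.le
  have h2 : CircleIntegrable (fun w : ℂ ↦ (w - z)⁻¹) 0 ρ :=
    ((continuousOn_id.sub continuousOn_const).inv₀ hwz).circleIntegrable hρ.le
  have h3 : (∮ w in C(0, ρ), w⁻¹) = 2 * Real.pi * I := by
    simpa using circleIntegral.integral_sub_center_inv (0 : ℂ) hρ.ne'
  rw [Real.circleAverage_eq_circleIntegral hρ.ne',
    circleIntegral.integral_congr (g := fun w ↦ z⁻¹ • (w⁻¹ - (w - z)⁻¹)) hρ.le,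
    circleIntegral.integral_smul, circleIntegral.integral_sub h1 h2, h3]
  · have hpi : (2 * Real.pi * I : ℂ) ≠ 0 := two_pi_I_ne_zero
    split_ifs with h
    · have : (∮ w in C(0, ρ), (w - z)⁻¹) = 0 := by
        refine circleIntegral_eq_zero_of_differentiable_on_off_countable hρ.le
          Set.countable_empty ?_ ?_
        · refine (continuousOn_id.sub continuousOn_const).inv₀ fun w hw h' ↦ ?_
          obtain rfl : w = z := sub_eq_zero.1 h'
          simp at hw
          linarith
        · rintro w ⟨hw, -⟩
          refine (differentiableAt_id.sub_const z).inv fun h' ↦ ?_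
          obtain rfl : w = z := sub_eq_zero.1 h'
          simp at hw
          linarith
      rw [this, sub_zero, smul_eq_mul, smul_eq_mul]
      field_simp
    · rw [circleIntegral.integral_sub_inv_of_mem_ball]
      · simp
      · simpa using lt_of_le_of_ne (not_lt.1 h) hne.symm
  · intro w hw
    have := hw0 w hw
    have h := hwz w hw
    have h' : z - w ≠ 0 := by rwa [← neg_sub, neg_ne_zero]
    simp only [sub_zero, smul_eq_mul]
    rw [← neg_sub w z]
    field_simp
    ring

/-- The kernel `‖z‖⁻¹` is integrable on bounded subsets of the plane. -/
theorem integrable_indicator_norm_inv (R : ℝ) :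
    Integrable (fun z : ℂ ↦ (Set.Iic R).indicator (fun s : ℝ ↦ s⁻¹) ‖z‖) := by
  rw [integrable_fun_norm_addHaar volume (f := (Set.Iic R).indicator (fun s : ℝ ↦ s⁻¹))]
  have : IntegrableOn ((Set.Iic R).indicator (fun _ : ℝ ↦ (1 : ℝ))) (Set.Ioi 0) := by
    rw [IntegrableOn, integrable_indicator_iff measurableSet_Iic, IntegrableOn,
      Measure.restrict_restrict measurableSet_Iic, Set.inter_comm, Set.Ioi_inter_Iic]
    exact integrableOn_const (by simp)
  refine this.congr_fun (fun s hs ↦ ?_) measurableSet_Ioi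
  have : s ≠ 0 := (Set.mem_Ioi.1 hs).ne'
  by_cases h : s ∈ Set.Iic R <;> simp [h, this]

/-- A continuous compactly supported radial density is integrable against the Cauchy kernel. -/
theorem integrable_radial_mul_sub_inv {g : ℝ → ℝ} (hg : Continuous g) (hsupp : HasCompactSupport g)
    (z : ℂ) : Integrable (fun w : ℂ ↦ (g ‖w‖ : ℂ) * (z - w)⁻¹) := by
  obtain ⟨C, hC⟩ := hsupp.exists_bound_of_continuous hg
  obtain ⟨R, hR⟩ := hsupp.isCompact.isBounded.subset_closedBall 0
  have hmeas : Measurable (fun w : ℂ ↦ (g ‖w‖ : ℂ) * (z - w)⁻¹) := by fun_prop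
  refine (((integrable_indicator_norm_inv (‖z‖ + R)).comp_sub_left z).const_mul C).mono'
    hmeas.aestronglyMeasurable (.of_forall fun w ↦ ?_)
  have hC0 : 0 ≤ C := (norm_nonneg _).trans (hC 0)
  by_cases hw : g ‖w‖ = 0
  · rw [hw]
    have : 0 ≤ (Set.Iic (‖z‖ + R)).indicator (fun s : ℝ ↦ s⁻¹) ‖z - w‖ :=
      Set.indicator_apply_nonneg fun _ ↦ by positivity
    simpa using mul_nonneg hC0 this
  · have h1 : ‖w‖ ≤ R := by
      simpa using hR (subset_tsupport g hw)
    have h2 : ‖z - w‖ ∈ Set.Iic (‖z‖ + R) := (norm_sub_le z w).trans (by linarith)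
    rw [Set.indicator_of_mem h2, norm_mul, norm_inv, Complex.norm_real]
    exact mul_le_mul_of_nonneg_right (hC _) (by positivity)

/-- Integrability in polar coordinates on `ℂ`. -/
theorem Complex.integrableOn_comp_polarCoord_symm {E : Type*} [NormedAddCommGroup E]
    [NormedSpace ℝ E] {f : ℂ → E} (hm : StronglyMeasurable f) (hf : Integrable f) :
    IntegrableOn (fun p : ℝ × ℝ ↦ p.1 • f (Complex.polarCoord.symm p)) polarCoord.target := by
  have hc : Measurable (fun p : ℝ × ℝ ↦ Complex.polarCoord.symm p) := by
    simp only [Complex.polarCoord_symm_apply]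
    fun_prop
  refine ⟨(measurable_fst.stronglyMeasurable.smul
    (hm.comp_measurable hc)).aestronglyMeasurable, ?_⟩
  rw [HasFiniteIntegral]
  have h := Complex.lintegral_comp_polarCoord_symm (fun w ↦ ‖f w‖ₑ)
  have h' := hf.2
  rw [HasFiniteIntegral, ← h] at h'
  refine lt_of_eq_of_lt (setLIntegral_congr_fun polarCoord.open_target.measurableSet
    fun p hp ↦ ?_) h'
  have : 0 < p.1 := hp.1
  simp only [enorm_smul, smul_eq_mul]
  rw [Real.enorm_of_nonneg this.le]

/-- The Cauchy transform of a radial density at a point `z ≠ 0` sees only the mass inside the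
circle through `z`. -/
theorem integral_radial_mul_sub_inv {g : ℝ → ℝ} (hg : Continuous g) (hsupp : HasCompactSupport g)
    {z : ℂ} (hz : z ≠ 0) :
    ∫ w : ℂ, (g ‖w‖ : ℂ) * (z - w)⁻¹ =
      ((2 * Real.pi * ∫ s in (0 : ℝ)..‖z‖, g s * s : ℝ) : ℂ) * z⁻¹ := by
  have hint := integrable_radial_mul_sub_inv hg hsupp z
  have hmeas : Measurable (fun w : ℂ ↦ (g ‖w‖ : ℂ) * (z - w)⁻¹) := by fun_prop
  have hpol := Complex.integrableOn_comp_polarCoord_symm hmeas.stronglyMeasurable hint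
  rw [← Complex.integral_comp_polarCoord_symm]
  change IntegrableOn _ (Set.Ioi (0 : ℝ) ×ˢ Set.Ioo (-Real.pi) Real.pi) _ at hpol
  change ∫ p in Set.Ioi (0 : ℝ) ×ˢ Set.Ioo (-Real.pi) Real.pi, _ = _
  rw [Measure.volume_eq_prod] at hpol ⊢
  rw [setIntegral_prod _ hpol]
  have hcirc : ∀ ρ : ℝ, ∫ θ in Set.Ioo (-Real.pi) Real.pi,
      (z - Complex.polarCoord.symm (ρ, θ))⁻¹ =
        (2 * Real.pi) • Real.circleAverage (fun w ↦ (z - w)⁻¹) 0 ρ := by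
    intro ρ
    rw [Real.circleAverage_eq_integral_add (-Real.pi),
      intervalIntegral.integral_comp_add_right (fun θ ↦ (z - circleMap 0 ρ θ)⁻¹),
      smul_smul, mul_inv_cancel₀ Real.two_pi_pos.ne', one_smul,
      intervalIntegral.integral_of_le (by linarith [Real.pi_pos]), integral_Ioc_eq_integral_Ioo]
    have : 2 * Real.pi + -Real.pi = Real.pi := by ring
    rw [this, zero_add]
    simp [circleMap, Complex.exp_mul_I]
  have hinner : ∀ᵐ ρ : ℝ ∂volume.restrict (Set.Ioi 0),
      ∫ θ in Set.Ioo (-Real.pi) Real.pi, (ρ, θ).1 •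
        ((g ‖Complex.polarCoord.symm (ρ, θ)‖ : ℂ) * (z - Complex.polarCoord.symm (ρ, θ))⁻¹) =
      (Set.Iio ‖z‖).indicator
        (fun s ↦ ((g s * s : ℝ) : ℂ) * ((2 * Real.pi : ℝ) * z⁻¹)) ρ := by
    have hne : ∀ᵐ ρ : ℝ ∂volume.restrict (Set.Ioi 0), ρ ≠ ‖z‖ :=
      ae_restrict_of_ae (Measure.ae_ne volume ‖z‖)
    filter_upwards [hne, ae_restrict_mem measurableSet_Ioi] with ρ h1 h2
    have h2 : 0 < ρ := h2
    simp only [Complex.norm_polarCoord_symm, abs_of_pos h2]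
    rw [integral_smul, integral_const_mul, hcirc, circleAverage_sub_inv_eq_ite hz h2 h1]
    by_cases h : ρ < ‖z‖
    · rw [if_pos h, Set.indicator_of_mem (Set.mem_Iio.2 h)]
      simp only [Complex.real_smul]
      push_cast
      ring
    · rw [if_neg h, Set.indicator_of_notMem (by simpa using h)]
      simp
  rw [integral_congr_ae hinner, setIntegral_indicator measurableSet_Iio, Set.Ioi_inter_Iio,
    integral_mul_const, integral_complex_ofReal, ← integral_Ioc_eq_integral_Ioo,
    ← intervalIntegral.integral_of_le (norm_nonneg z)]
  push_cast
  ring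

theorem radial_kernel_integral (g : ℝ → ℝ) (hg : Continuous g)
    (hsupp : HasCompactSupport g)
    (x : EuclideanSpace ℝ (Fin 2)) (hx : 0 < ‖x‖) :
    Integrable (fun y : EuclideanSpace ℝ (Fin 2) =>
        (g ‖y‖ / ‖x - y‖ ^ 2) • (x - y))
    ∧ ∫ y : EuclideanSpace ℝ (Fin 2), (g ‖y‖ / ‖x - y‖ ^ 2) • (x - y)
      = ((2 * Real.pi / ‖x‖ ^ 2) * ∫ s in (0 : ℝ)..‖x‖, g s * s) • x := by
  let e : ℂ ≃ₗᵢ[ℝ] EuclideanSpace ℝ (Fin 2) := Complex.orthonormalBasisOneI.repr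
  let L : ℂ ≃ₗᵢ[ℝ] EuclideanSpace ℝ (Fin 2) := Complex.conjLIE.trans e
  have hmp : MeasurePreserving e := e.measurePreserving
  have hemb : MeasurableEmbedding e := e.toHomeomorph.measurableEmbedding
  obtain ⟨z, rfl⟩ := e.surjective x
  rw [e.norm_map] at hx ⊢
  have hz : z ≠ 0 := norm_pos_iff.1 hx
  have hinv : ∀ w : ℂ, Complex.conjLIE w⁻¹ = (‖w‖ ^ 2)⁻¹ • w := by
    intro w
    rw [Complex.conjLIE_apply, Complex.inv_def, map_mul, Complex.conj_conj, Complex.conj_ofReal,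
      Complex.normSq_eq_norm_sq, Complex.real_smul, mul_comm]
  have hcomp : (fun y ↦ (g ‖y‖ / ‖e z - y‖ ^ 2) • (e z - y)) ∘ e =
      fun w : ℂ ↦ L ((g ‖w‖ : ℂ) * (z - w)⁻¹) := by
    ext1 w
    rw [← Complex.real_smul, L.map_smul, LinearIsometryEquiv.trans_apply, hinv, e.map_smul]
    simp only [Function.comp_apply, ← map_sub, e.norm_map, smul_smul, div_eq_mul_inv]
  have hint := integrable_radial_mul_sub_inv hg hsupp z
  constructor
  · rw [← hmp.integrable_comp_emb hemb, hcomp]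
    exact L.toContinuousLinearEquiv.toContinuousLinearMap.integrable_comp hint
  · rw [← hmp.integral_comp hemb]
    change ∫ w, ((fun y ↦ (g ‖y‖ / ‖e z - y‖ ^ 2) • (e z - y)) ∘ e) w = _
    rw [hcomp]
    have := L.toContinuousLinearEquiv.toContinuousLinearMap.integral_comp_comm hint
    refine this.trans ?_
    rw [integral_radial_mul_sub_inv hg hsupp hz, ← Complex.real_smul]
    change L _ = _
    rw [L.map_smul, LinearIsometryEquiv.trans_apply, hinv, e.map_smul, smul_smul]
    congr 1
    ring
end

section
/- Let a > 0, c > 0, N > 0, and 0 < R < 1. Set ω := a/(1 − R²) + cN/R² and define ρ(r) := (1/(πc))·(ω − a/(1 − r²)²) for 0 ≤ r ≤ R. Then: (i) 2π·∫₀^R ρ(s)·s ds = N; and (ii) for every r with 0 < r ≤ R, a/(1 − r²) − ω + (2πc/r²)·∫₀^r ρ(s)·s ds = 0. -/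
theorem integral_sub_div_one_sub_sq_sq_mul (k ω a r : ℝ) (hr0 : 0 ≤ r) (hr1 : r < 1) :
    ∫ s in (0 : ℝ)..r, k * (ω - a / (1 - s ^ 2) ^ 2) * s =
      k * (r ^ 2 / 2) * (ω - a / (1 - r ^ 2)) := by
  have hne : ∀ s ∈ Set.uIcc 0 r, 1 - s ^ 2 ≠ 0 := by
    intro s hs
    rw [Set.uIcc_of_le hr0] at hs
    nlinarith [hs.1, hs.2]
  have hderiv : ∀ s ∈ Set.uIcc 0 r,
      HasDerivAt (fun s : ℝ => k * (s ^ 2 / 2) * (ω - a / (1 - s ^ 2)))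
        (k * (ω - a / (1 - s ^ 2) ^ 2) * s) s := by
    intro s hs
    have hs' := hne s hs
    have hsq : HasDerivAt (fun s : ℝ => s ^ 2) (2 * s) s := by
      simpa using hasDerivAt_pow 2 s
    have hquot := (hasDerivAt_const s a).fun_div (hsq.const_sub 1) hs'
    refine (((hsq.div_const 2).const_mul k).fun_mul (hquot.const_sub ω)).congr_deriv ?_
    field_simp
    ring
  have hcont : ContinuousOn (fun s : ℝ => k * (ω - a / (1 - s ^ 2) ^ 2) * s)
      (Set.uIcc 0 r) := by
    refine ContinuousOn.mul (continuousOn_const.mul (continuousOn_const.sub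
      (continuousOn_const.div (by fun_prop) fun s hs => ?_))) continuousOn_id
    exact pow_ne_zero 2 (hne s hs)
  rw [intervalIntegral.integral_eq_sub_of_hasDerivAt hderiv hcont.intervalIntegrable]
  simp

theorem continuum_steady_state (a c N R : ℝ) (ha : 0 < a) (hc : 0 < c)
    (hN : 0 < N) (hR0 : 0 < R) (hR1 : R < 1) (ω : ℝ)
    (hω : ω = a / (1 - R ^ 2) + c * N / R ^ 2) (ρ : ℝ → ℝ)
    (hρ : ∀ r : ℝ, 0 ≤ r → r ≤ R →
        ρ r = (1 / (Real.pi * c)) * (ω - a / (1 - r ^ 2) ^ 2)) :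
    2 * Real.pi * ∫ s in (0 : ℝ)..R, ρ s * s = N
    ∧ ∀ r : ℝ, 0 < r → r ≤ R →
        a / (1 - r ^ 2) - ω + (2 * Real.pi * c / r ^ 2) * ∫ s in (0 : ℝ)..r, ρ s * s = 0 := by
  have hint : ∀ r : ℝ, 0 < r → r ≤ R → ∫ s in (0 : ℝ)..r, ρ s * s =
      1 / (Real.pi * c) * (r ^ 2 / 2) * (ω - a / (1 - r ^ 2)) := by
    intro r hr hrR
    rw [← integral_sub_div_one_sub_sq_sq_mul _ _ _ _ hr.le (hrR.trans_lt hR1)]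
    refine intervalIntegral.integral_congr fun s hs => ?_
    rw [Set.uIcc_of_le hr.le] at hs
    simp only [hρ s hs.1 (hs.2.trans hrR)]
  have hπ := Real.pi_ne_zero
  constructor
  · have hsub : ω - a / (1 - R ^ 2) = c * N / R ^ 2 := by rw [hω]; ring
    rw [hint R hR0 le_rfl, hsub]
    field_simp
  · intro r hr hrR
    rw [hint r hr hrR]
    generalize a / (1 - r ^ 2) = f
    field_simp
    ring
end

section
/- Let a > 0 and c, N > 0, and define g(R) := a/(1 − R²) + cN/R² for 0 < R < 1. Then g is strictly decreasing on (0, R_c] and strictly increasing on [R_c, 1), where R_c ∈ (0,1) is determined by R_c² = √(cN)/(√a + √(cN)); the minimum value is g(R_c) = (√a + √(cN))² =: ω_c. Moreover the continuum density vanishes exactly at the critical radius: ω_c − a/(1 − R_c²)² = 0. -/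
theorem div_one_sub_add_div_sub (A B u v : ℝ) (hu : u ≠ 0) (hv : v ≠ 0) (hu' : 1 - u ≠ 0)
    (hv' : 1 - v ≠ 0) :
    (A / (1 - u) + B / u) - (A / (1 - v) + B / v) =
      (v - u) * (B * ((1 - u) * (1 - v)) - A * (u * v)) / (u * v * ((1 - u) * (1 - v))) := by
  field_simp
  ring

theorem support_radius_critical_point (a c N : ℝ) (ha : 0 < a) (hc : 0 < c)
    (hN : 0 < N) (g : ℝ → ℝ)
    (hg : ∀ R : ℝ, g R = a / (1 - R ^ 2) + c * N / R ^ 2)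
    (Rc ωc : ℝ) (hRc0 : 0 < Rc)
    (hRcsq : Rc ^ 2 = Real.sqrt (c * N) / (Real.sqrt a + Real.sqrt (c * N)))
    (hωc : ωc = (Real.sqrt a + Real.sqrt (c * N)) ^ 2) :
    Rc < 1
    ∧ StrictAntiOn g (Set.Ioc 0 Rc)
    ∧ StrictMonoOn g (Set.Ico Rc 1)
    ∧ g Rc = ωc
    ∧ ωc - a / (1 - Rc ^ 2) ^ 2 = 0 := by
  have hcN : 0 < c * N := mul_pos hc hN
  have hp : 0 < √a := Real.sqrt_pos.2 ha
  have hq : 0 < √(c * N) := Real.sqrt_pos.2 hcN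
  have hpa : a = √a ^ 2 := (Real.sq_sqrt ha.le).symm
  have hqc : c * N = √(c * N) ^ 2 := (Real.sq_sqrt hcN.le).symm
  generalize √a = p at *
  generalize √(c * N) = q at *
  have hpq : 0 < p + q := add_pos hp hq
  have h1 : 1 - Rc ^ 2 = p / (p + q) := by rw [hRcsq]; field_simp; ring
  have hbal : p * Rc ^ 2 = q * (1 - Rc ^ 2) := by rw [h1, hRcsq]; ring
  have hlt : Rc < 1 := by
    have : 0 < 1 - Rc ^ 2 := h1 ▸ div_pos hp hpq
    nlinarith
  refine ⟨hlt, ?_, ?_, ?_, ?_⟩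
  · intro x hx y hy hxy
    have hx0 : 0 < x ^ 2 := pow_pos hx.1 2
    have hy0 : 0 < y ^ 2 := pow_pos hy.1 2
    have hxy2 : x ^ 2 < y ^ 2 := pow_lt_pow_left₀ hxy hx.1.le two_ne_zero
    have hyc : y ^ 2 ≤ Rc ^ 2 := pow_le_pow_left₀ hy.1.le hy.2 2
    have hy1 : 0 < 1 - y ^ 2 := by nlinarith
    have hx1 : 0 < 1 - x ^ 2 := by linarith
    have hxb : p * x ^ 2 < q * (1 - x ^ 2) := by nlinarith
    have hyb : p * y ^ 2 ≤ q * (1 - y ^ 2) := by nlinarith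
    have key : (p * x ^ 2) * (p * y ^ 2) < (q * (1 - x ^ 2)) * (q * (1 - y ^ 2)) :=
      mul_lt_mul hxb hyb (by positivity) (by positivity)
    rw [← sub_pos, hg, hg, div_one_sub_add_div_sub _ _ _ _ hx0.ne' hy0.ne' hx1.ne' hy1.ne', hpa,
      hqc]
    exact div_pos (mul_pos (by linarith) (by linarith)) (by positivity)
  · intro x hx y hy hxy
    have hxpos : 0 < x := hRc0.trans_le hx.1
    have hypos : 0 < y := hxpos.trans hxy
    have hx0 : 0 < x ^ 2 := pow_pos hxpos 2
    have hy0 : 0 < y ^ 2 := pow_pos hypos 2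
    have hxy2 : x ^ 2 < y ^ 2 := pow_lt_pow_left₀ hxy hxpos.le two_ne_zero
    have hxc : Rc ^ 2 ≤ x ^ 2 := pow_le_pow_left₀ hRc0.le hx.1 2
    have hy1 : 0 < 1 - y ^ 2 := by nlinarith [hy.2]
    have hx1 : 0 < 1 - x ^ 2 := by linarith
    have hxb : q * (1 - x ^ 2) ≤ p * x ^ 2 := by nlinarith
    have hyb : q * (1 - y ^ 2) < p * y ^ 2 := by nlinarith
    have key : (q * (1 - y ^ 2)) * (q * (1 - x ^ 2)) < (p * y ^ 2) * (p * x ^ 2) :=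
      mul_lt_mul hyb hxb (by positivity) (by positivity)
    rw [← sub_neg, hg, hg, div_one_sub_add_div_sub _ _ _ _ hx0.ne' hy0.ne' hx1.ne' hy1.ne', hpa,
      hqc]
    exact div_neg_of_neg_of_pos (mul_neg_of_pos_of_neg (by linarith) (by linarith)) (by positivity)
  · rw [hg, h1, hRcsq, hωc, hpa, hqc]
    field_simp
  · rw [h1, hωc, hpa]
    field_simp
    ring
end

section
/- Let a > 0, c, N > 0 and ω > ω_c := (√a + √(cN))². Define h(R) := R·(a/(1 − R²) − ω) + cN/R on (0,1), and let R₋ < R_c < R₊ be the two zeros of h in (0,1) (equivalently, the two solutions of a/(1 − R²) + cN/R² = ω), where R_c² = √(cN)/(√a + √(cN)). Then h(R) = R·(g(R) − ω) with g(R) = a/(1 − R²) + cN/R², and h′(R₋) < 0 while h′(R₊) > 0; that is, R₋ is a stable equilibrium and R₊ an unstable equilibrium of the support-radius ODE dR/dt = h(R). -/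
/-- At an equilibrium, the slope of the support-radius vector field factors so that its sign is
that of `p * R ^ 2 - q * (1 - R ^ 2)`. -/
theorem hasDerivAt_supportRadius_of_eq_zero {p q ω R : ℝ} (hR0 : 0 < R) (hR1 : R < 1)
    (hz : R * (p ^ 2 / (1 - R ^ 2) - ω) + q ^ 2 / R = 0) :
    HasDerivAt (fun x : ℝ => x * (p ^ 2 / (1 - x ^ 2) - ω) + q ^ 2 / x)
      ((p * R ^ 2 - q * (1 - R ^ 2)) *
        (2 * (p * R ^ 2 + q * (1 - R ^ 2)) / (R ^ 2 * (1 - R ^ 2) ^ 2))) R := by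
  have hR : R ≠ 0 := hR0.ne'
  have h1 : 1 - R ^ 2 ≠ 0 := by nlinarith
  have hω : ω = p ^ 2 / (1 - R ^ 2) + q ^ 2 / R ^ 2 := by
    field_simp at hz ⊢
    linarith
  have hd : HasDerivAt (fun x : ℝ => 1 - x ^ 2) (-(2 * R)) R := by
    simpa using (hasDerivAt_pow 2 R).const_sub 1
  have hf := ((hasDerivAt_id R).mul
    (((hasDerivAt_const R (p ^ 2)).div hd h1).sub_const ω)).add
    ((hasDerivAt_const R (q ^ 2)).div (hasDerivAt_id R) hR)
  refine hf.congr_deriv ?_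
  simp only [id, Pi.div_apply, hω]
  field_simp
  ring


theorem support_radius_stability (a c N ω : ℝ) (ha : 0 < a) (hc : 0 < c)
    (hN : 0 < N) (ωc : ℝ) (hωc : ωc = (Real.sqrt a + Real.sqrt (c * N)) ^ 2)
    (hω : ωc < ω) (g h : ℝ → ℝ)
    (hg : ∀ R : ℝ, g R = a / (1 - R ^ 2) + c * N / R ^ 2)
    (hh : ∀ R : ℝ, h R = R * (a / (1 - R ^ 2) - ω) + c * N / R)
    (Rc Rm Rp : ℝ) (hRc0 : 0 < Rc)
    (hRcsq : Rc ^ 2 = Real.sqrt (c * N) / (Real.sqrt a + Real.sqrt (c * N)))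
    (hRm0 : 0 < Rm) (hRmRc : Rm < Rc) (hRcRp : Rc < Rp) (hRp1 : Rp < 1)
    (hzm : h Rm = 0) (hzp : h Rp = 0) :
    (∀ R : ℝ, h R = R * (g R - ω)) ∧ deriv h Rm < 0 ∧ 0 < deriv h Rp := by
  obtain rfl : h = fun R => R * (a / (1 - R ^ 2) - ω) + c * N / R := funext hh
  beta_reduce at hzm hzp
  have hp : 0 < √a := Real.sqrt_pos.2 ha
  have hq : 0 < √(c * N) := Real.sqrt_pos.2 (mul_pos hc hN)
  have hpa : √a ^ 2 = a := Real.sq_sqrt ha.le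
  have hqa : √(c * N) ^ 2 = c * N := Real.sq_sqrt (mul_pos hc hN).le
  generalize √a = p at *
  generalize √(c * N) = q at *
  have hRc : Rc ^ 2 * (p + q) = q := by
    rw [hRcsq]
    field_simp
  have hfac (R : ℝ) : p * R ^ 2 - q * (1 - R ^ 2) = (p + q) * (R ^ 2 - Rc ^ 2) := by
    linear_combination hRc
  have hpos {R : ℝ} (hR0 : 0 < R) (hR1 : R < 1) :
      0 < 2 * (p * R ^ 2 + q * (1 - R ^ 2)) / (R ^ 2 * (1 - R ^ 2) ^ 2) := by
    have : 0 < 1 - R ^ 2 := by nlinarith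
    positivity
  have hRp0 : 0 < Rp := hRc0.trans hRcRp
  have hRm1 : Rm < 1 := hRmRc.trans (hRcRp.trans hRp1)
  refine ⟨fun R => ?_, ?_, ?_⟩
  · rw [hg]
    rcases eq_or_ne R 0 with rfl | hR
    · simp
    · have : c * N / R = R * (c * N / R ^ 2) := by field_simp
      dsimp only
      rw [this]
      ring
  · rw [← hpa, ← hqa] at hzm ⊢
    rw [(hasDerivAt_supportRadius_of_eq_zero hRm0 hRm1 hzm).deriv, hfac]
    exact mul_neg_of_neg_of_pos (mul_neg_of_pos_of_neg (by positivity) (by nlinarith))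
      (hpos hRm0 hRm1)
  · rw [← hpa, ← hqa] at hzp ⊢
    rw [(hasDerivAt_supportRadius_of_eq_zero hRp0 hRp1 hzp).deriv, hfac]
    exact mul_pos (mul_pos (by positivity) (by nlinarith)) (hpos hRp0 hRp1)
end
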